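/- A dcpo P is a continuous domain if and only if P is a quasicontinuous domain and P is meet-continuous. -/

import Mathlib

open Set

/-- The upper set `↑A` generated by a subset `A` of a preordered set. -/
def upSet {P : Type*} [Preorder P] (A : Set P) : Set P := {y | ∃ a ∈ A, a ≤ y}

/-- The lower set `↓A` generated by a subset `A` of a preordered set. -/
def downSet {P : Type*} [Preorder P] (A : Set P) : Set P := {y | ∃ a ∈ A, y ≤ a}

/-- A poset is a dcpo if every (nonempty) directed subset has a least upper bound. -/
def IsDcpo (P : Type*) [Preorder P] : Prop :=
  ∀ D : Set P, D.Nonempty → DirectedOn (· ≤ ·) D → ∃ s, IsLUB D s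

/-- A subset `U` is Scott open if it is an upper set and every directed set whose
supremum lies in `U` meets `U`. -/
def ScottOpen {P : Type*} [Preorder P] (U : Set P) : Prop :=
  IsUpperSet U ∧ ∀ D : Set P, ∀ s : P, D.Nonempty → DirectedOn (· ≤ ·) D →
    IsLUB D s → s ∈ U → (D ∩ U).Nonempty

/-- The Scott topology `σ(P)`. -/
def scottT (P : Type*) [Preorder P] : TopologicalSpace P where
  IsOpen := ScottOpen
  isOpen_univ := ⟨isUpperSet_univ, fun D _ hD _ _ _ => hD.imp fun _ hd => ⟨hd, trivial⟩⟩
  isOpen_inter := by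
    rintro U V ⟨hU, hU'⟩ ⟨hV, hV'⟩
    refine ⟨hU.inter hV, fun D s hD hdir hlub hs => ?_⟩
    obtain ⟨d₁, hd₁D, hd₁U⟩ := hU' D s hD hdir hlub hs.1
    obtain ⟨d₂, hd₂D, hd₂V⟩ := hV' D s hD hdir hlub hs.2
    obtain ⟨d, hdD, h₁, h₂⟩ := hdir d₁ hd₁D d₂ hd₂D
    exact ⟨d, hdD, hU h₁ hd₁U, hV h₂ hd₂V⟩
  isOpen_sUnion := by
    intro S hS
    refine ⟨isUpperSet_sUnion fun U hU => (hS U hU).1, fun D s hD hdir hlub hs => ?_⟩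
    obtain ⟨U, hUS, hsU⟩ := hs
    obtain ⟨d, hdD, hdU⟩ := (hS U hUS).2 D s hD hdir hlub hsU
    exact ⟨d, hdD, U, hUS, hdU⟩

/-- Scott interior. -/
def scottInt (P : Type*) [Preorder P] (A : Set P) : Set P := @interior P (scottT P) A

/-- Scott closure. -/
def scottCl (P : Type*) [Preorder P] (A : Set P) : Set P := @closure P (scottT P) A

/-- The lower topology `ω(P)`, generated by the complements of principal upper sets. -/
def lowerT (P : Type*) [Preorder P] : TopologicalSpace P :=
  .generateFrom {V | ∃ x : P, V = (Ici x)ᶜ}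

/-- The upper topology `υ(P)`, generated by the complements of principal lower sets. -/
def upperT (P : Type*) [Preorder P] : TopologicalSpace P :=
  .generateFrom {V | ∃ x : P, V = (Iic x)ᶜ}

/-- The Lawson topology `λ(P)`, generated by `σ(P) ∪ ω(P)`. -/
def lawsonT (P : Type*) [Preorder P] : TopologicalSpace P :=
  .generateFrom ({U | ScottOpen U} ∪ {V | ∃ x : P, V = (Ici x)ᶜ})

/-- The interval topology `θ(P)`, generated by `ω(P) ∪ υ(P)`. -/
def intervalT (P : Type*) [Preorder P] : TopologicalSpace P :=
  .generateFrom ({V | ∃ x : P, V = (Ici x)ᶜ} ∪ {V | ∃ x : P, V = (Iic x)ᶜ})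

/-- `A ≪ B`: for every directed set `D` with `sup D ∈ ↑B`, `D` meets `↑A`. -/
def WayBelowSet {P : Type*} [Preorder P] (A B : Set P) : Prop :=
  ∀ D : Set P, ∀ s : P, D.Nonempty → DirectedOn (· ≤ ·) D → IsLUB D s →
    s ∈ upSet B → (D ∩ upSet A).Nonempty

/-- `u ≪ x`: every directed set `D` with `sup D ≥ x` contains some `d ≥ u`. -/
def WayBelowPt {P : Type*} [Preorder P] (u x : P) : Prop :=
  ∀ D : Set P, ∀ s : P, D.Nonempty → DirectedOn (· ≤ ·) D → IsLUB D s →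
    x ≤ s → ∃ d ∈ D, u ≤ d

/-- A family of sets is filtered if it is (nonempty and) directed under reverse inclusion. -/
def Filtered {P : Type*} (𝒜 : Set (Set P)) : Prop :=
  𝒜.Nonempty ∧ ∀ S ∈ 𝒜, ∀ T ∈ 𝒜, ∃ R ∈ 𝒜, R ⊆ S ∧ R ⊆ T

/-- The family `{↑F : F nonempty finite, F ≪ x}`. -/
def finWayFamily {P : Type*} [Preorder P] (x : P) : Set (Set P) :=
  {S | ∃ F : Set P, F.Nonempty ∧ F.Finite ∧ WayBelowSet F {x} ∧ S = upSet F}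

/-- A quasicontinuous domain. -/
def IsQuasicontinuousDomain (P : Type*) [Preorder P] : Prop :=
  ∀ x : P, Filtered (finWayFamily x) ∧ Ici x = ⋂₀ finWayFamily x

/-- The family `{↑F : F nonempty finite, x ∈ ↑F, F ≪ F}`. -/
def finCompactFamily {P : Type*} [Preorder P] (x : P) : Set (Set P) :=
  {S | ∃ F : Set P, F.Nonempty ∧ F.Finite ∧ x ∈ upSet F ∧ WayBelowSet F F ∧ S = upSet F}

/-- A quasialgebraic domain. -/
def IsQuasialgebraicDomain (P : Type*) [Preorder P] : Prop :=
  ∀ x : P, Filtered (finCompactFamily x) ∧ Ici x = ⋂₀ finCompactFamily x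

/-- A continuous domain: every `⇓x` is directed (hence nonempty) with supremum `x`. -/
def IsContinuousDomain (P : Type*) [Preorder P] : Prop :=
  ∀ x : P, {u | WayBelowPt u x}.Nonempty ∧ DirectedOn (· ≤ ·) {u | WayBelowPt u x} ∧
    IsLUB {u | WayBelowPt u x} x

/-- The set `K(P)` of compact elements. -/
def compacts (P : Type*) [Preorder P] : Set P := {k | WayBelowPt k k}

/-- An algebraic domain. -/
def IsAlgebraicDomain (P : Type*) [Preorder P] : Prop :=
  ∀ x : P, (compacts P ∩ Iic x).Nonempty ∧ DirectedOn (· ≤ ·) (compacts P ∩ Iic x) ∧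
    IsLUB (compacts P ∩ Iic x) x

/-- A meet-continuous dcpo: whenever `x ≤ sup D` for a directed set `D`,
`x` lies in the Scott closure of `↓x ∩ ↓D`. -/
def MeetContinuous (P : Type*) [Preorder P] : Prop :=
  ∀ x : P, ∀ D : Set P, ∀ s : P, D.Nonempty → DirectedOn (· ≤ ·) D → IsLUB D s → x ≤ s →
    x ∈ scottCl P (Iic x ∩ downSet D)

/-- The set of dyadic rationals in `[0,1]`. -/
def dyadics : Set ℝ := {t | ∃ m n : ℕ, m ≤ 2 ^ n ∧ t = (m : ℝ) / 2 ^ n}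

section RudinLemma

variable {P : Type*} [Preorder P]

lemma isUpperSet_upSet (A : Set P) : IsUpperSet (upSet A) :=
  fun _ _ hxy ⟨a, ha, hax⟩ => ⟨a, ha, hax.trans hxy⟩

lemma subset_upSet (A : Set P) : A ⊆ upSet A := fun a ha => ⟨a, ha, le_rfl⟩

/-- A nonempty chain of sets, each meeting a fixed finite set, has an intersection that meets
this finite set. -/
lemma IsChain.sInter_inter_finite_nonempty {α : Type*} {c : Set (Set α)} {G : Set α}
    (hc : IsChain (· ⊆ ·) c) (hne : c.Nonempty) (hG : G.Finite)
    (h : ∀ A ∈ c, (A ∩ G).Nonempty) : (⋂₀ c ∩ G).Nonempty := by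
  have hfin : ((· ∩ G) '' c).Finite :=
    hG.finite_subsets.subset (by rintro _ ⟨A, -, rfl⟩; exact inter_subset_right)
  obtain ⟨_, ⟨A, hA, rfl⟩, hmin⟩ := hfin.exists_minimal (hne.image _)
  obtain ⟨g, hgA, hgG⟩ := h A hA
  refine ⟨g, fun B hB => ?_, hgG⟩
  rcases hc.total hA hB with hAB | hBA
  · exact hAB hgA
  · exact (hmin (mem_image_of_mem _ hB) (inter_subset_inter_left G hBA) ⟨hgA, hgG⟩).1

/-- **Rudin's lemma**: a lower set `L` meeting every member of a filtered family of finite sets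
contains a directed set meeting every member of the family. -/
lemma exists_directedOn_subset_of_inter_nonempty {𝒢 : Set (Set P)} {L : Set P}
    (hfin : ∀ G ∈ 𝒢, G.Finite)
    (hfilt : ∀ G ∈ 𝒢, ∀ H ∈ 𝒢, ∃ K ∈ 𝒢, K ⊆ upSet G ∧ K ⊆ upSet H)
    (hL : IsLowerSet L) (hmeet : ∀ G ∈ 𝒢, (L ∩ G).Nonempty) :
    ∃ A ⊆ L, DirectedOn (· ≤ ·) A ∧ ∀ G ∈ 𝒢, (A ∩ G).Nonempty := by
  let S : Set (Set P) := {A | IsLowerSet A ∧ A ⊆ L ∧ ∀ G ∈ 𝒢, (A ∩ G).Nonempty}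
  obtain ⟨A, ⟨hAlow, hAL, hAmeet⟩, hmin⟩ : ∃ A, Minimal (· ∈ S) A := by
    refine zorn_superset S fun c hcS hc => ?_
    rcases c.eq_empty_or_nonempty with rfl | hne
    · exact ⟨L, ⟨hL, Subset.rfl, hmeet⟩, by simp⟩
    · obtain ⟨B, hB⟩ := hne
      refine ⟨⋂₀ c, ⟨isLowerSet_sInter fun A hA => (hcS hA).1,
        (sInter_subset_of_mem hB).trans (hcS hB).2.1, fun G hG => ?_⟩,
        fun A hA => sInter_subset_of_mem hA⟩
      exact hc.sInter_inter_finite_nonempty ⟨B, hB⟩ (hfin G hG)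
        fun A hA => (hcS hA).2.2 G hG
  have key : ∀ a ∈ A, ∃ G ∈ 𝒢, A ∩ G ⊆ Ici a := by
    intro a ha
    by_contra! hcon
    have hmem : A \ Ici a ∈ S := by
      refine ⟨hAlow.inter (isUpperSet_Ici a).compl, sdiff_subset.trans hAL, fun G hG => ?_⟩
      obtain ⟨g, ⟨hgA, hgG⟩, hag⟩ := not_subset.1 (hcon G hG)
      exact ⟨g, ⟨hgA, hag⟩, hgG⟩
    exact (hmin hmem sdiff_subset ha).2 self_mem_Ici
  refine ⟨A, hAL, fun a ha b hb => ?_, hAmeet⟩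
  obtain ⟨G, hG, hGa⟩ := key a ha
  obtain ⟨H, hH, hHb⟩ := key b hb
  obtain ⟨K, hK, hKG, hKH⟩ := hfilt G hG H hH
  obtain ⟨k, hkA, hkK⟩ := hAmeet K hK
  obtain ⟨g, hg, hgk⟩ := hKG hkK
  obtain ⟨h, hh, hhk⟩ := hKH hkK
  exact ⟨k, hkA, (hGa ⟨hAlow hgk hkA, hg⟩ : a ≤ g).trans hgk,
    (hHb ⟨hAlow hhk hkA, hh⟩ : b ≤ h).trans hhk⟩

/-- If an upper set `W` meets every directed set whose supremum lies in `⋂ ↑G`, for a filtered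
family of finite sets `G`, then `W` contains some `G`. -/
lemma exists_mem_subset_of_forall_directedOn (hdcpo : IsDcpo P) {𝒢 : Set (Set P)} {W : Set P}
    (hne : 𝒢.Nonempty) (hfin : ∀ G ∈ 𝒢, G.Finite)
    (hfilt : ∀ G ∈ 𝒢, ∀ H ∈ 𝒢, ∃ K ∈ 𝒢, K ⊆ upSet G ∧ K ⊆ upSet H)
    (hW : IsUpperSet W)
    (hmeet : ∀ D : Set P, ∀ t : P, D.Nonempty → DirectedOn (· ≤ ·) D → IsLUB D t →
      (∀ G ∈ 𝒢, t ∈ upSet G) → (D ∩ W).Nonempty) :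
    ∃ G ∈ 𝒢, G ⊆ W := by
  by_contra! hcon
  obtain ⟨A, hAW, hAdir, hA⟩ := exists_directedOn_subset_of_inter_nonempty hfin hfilt hW.compl
    fun G hG => by
      obtain ⟨g, hgG, hgW⟩ := not_subset.1 (hcon G hG)
      exact ⟨g, hgW, hgG⟩
  obtain ⟨G, hG⟩ := hne
  have hAne : A.Nonempty := (hA G hG).mono inter_subset_left
  obtain ⟨t, ht⟩ := hdcpo A hAne hAdir
  obtain ⟨a, haA, haW⟩ := hmeet A t hAne hAdir ht fun H hH => by
    obtain ⟨a, haA, haH⟩ := hA H hH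
    exact ⟨a, haH, ht.1 haA⟩
  exact hAW haA haW

end RudinLemma

section WayBelow

variable {P : Type*} [Preorder P]

lemma mem_upSet_singleton {x y : P} : y ∈ upSet {x} ↔ x ≤ y := by simp [upSet]

lemma WayBelowSet.mem_upSet {F : Set P} {x : P} (h : WayBelowSet F {x}) : x ∈ upSet F := by
  obtain ⟨_, rfl, hd⟩ := h {x} x (singleton_nonempty x) (directedOn_singleton x)
    isLUB_singleton (mem_upSet_singleton.2 le_rfl)
  exact hd

lemma WayBelowSet.mono_right {F : Set P} {x y : P} (h : WayBelowSet F {x}) (hxy : x ≤ y) :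
    WayBelowSet F {y} := fun D s hD hdir hs hy =>
  h D s hD hdir hs (mem_upSet_singleton.2 (hxy.trans (mem_upSet_singleton.1 hy)))

lemma WayBelowSet.mono_left {F G : Set P} {x : P} (h : WayBelowSet G {x}) (hGF : G ⊆ upSet F) :
    WayBelowSet F {x} := fun D s hD hdir hs hx => by
  obtain ⟨d, hdD, g, hg, hgd⟩ := h D s hD hdir hs hx
  exact ⟨d, hdD, isUpperSet_upSet F hgd (hGF hg)⟩

lemma WayBelowPt.wayBelowSet {u x : P} (h : WayBelowPt u x) : WayBelowSet {u} {x} :=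
  fun D s hD hdir hs hx => by
    obtain ⟨d, hdD, hud⟩ := h D s hD hdir hs (mem_upSet_singleton.1 hx)
    exact ⟨d, hdD, mem_upSet_singleton.2 hud⟩

lemma WayBelowPt.le {u x : P} (h : WayBelowPt u x) : u ≤ x :=
  mem_upSet_singleton.1 h.wayBelowSet.mem_upSet

lemma IsQuasicontinuousDomain.exists_finite_wayBelowSet (hq : IsQuasicontinuousDomain P)
    (x : P) : ∃ F : Set P, F.Finite ∧ WayBelowSet F {x} := by
  obtain ⟨_, F, -, hF, hFx, -⟩ := (hq x).1.1
  exact ⟨F, hF, hFx⟩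

lemma IsQuasicontinuousDomain.exists_finite_wayBelowSet_subset (hq : IsQuasicontinuousDomain P)
    {x : P} {F G : Set P} (hF : F.Finite) (hG : G.Finite) (hFx : WayBelowSet F {x})
    (hGx : WayBelowSet G {x}) :
    ∃ H : Set P, H.Finite ∧ WayBelowSet H {x} ∧ H ⊆ upSet F ∧ H ⊆ upSet G := by
  have nonempty {E : Set P} (hE : WayBelowSet E {x}) : E.Nonempty := by
    obtain ⟨a, ha, -⟩ := hE.mem_upSet
    exact ⟨a, ha⟩
  obtain ⟨_, ⟨H, -, hH, hHx, rfl⟩, hHF, hHG⟩ := (hq x).1.2 _ ⟨F, nonempty hFx, hF, hFx, rfl⟩ _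
    ⟨G, nonempty hGx, hG, hGx, rfl⟩
  exact ⟨H, hH, hHx, (subset_upSet H).trans hHF, (subset_upSet H).trans hHG⟩

lemma IsQuasicontinuousDomain.le_of_forall_mem_upSet (hq : IsQuasicontinuousDomain P) {x y : P}
    (h : ∀ F : Set P, F.Finite → WayBelowSet F {x} → y ∈ upSet F) : x ≤ y := by
  change y ∈ Ici x
  rw [(hq x).2]
  rintro _ ⟨F, -, hF, hFx, rfl⟩
  exact h F hF hFx

/-- In a quasicontinuous domain, `⇑F` is Scott open. -/
lemma IsQuasicontinuousDomain.scottOpen_setOf_wayBelowSet (hdcpo : IsDcpo P)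
    (hq : IsQuasicontinuousDomain P) (F : Set P) : ScottOpen {y | WayBelowSet F {y}} := by
  refine ⟨fun _ _ hxy h => h.mono_right hxy, fun D s hD hdir hs hFs => ?_⟩
  suffices h : ∃ G ∈ {G : Set P | G.Finite ∧ ∃ d ∈ D, WayBelowSet G {d}}, G ⊆ upSet F by
    obtain ⟨G, ⟨-, d, hdD, hGd⟩, hGF⟩ := h
    exact ⟨d, hdD, hGd.mono_left hGF⟩
  refine exists_mem_subset_of_forall_directedOn hdcpo ?_ (fun G hG => hG.1) ?_
    (isUpperSet_upSet F) ?_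
  · obtain ⟨d, hd⟩ := hD
    obtain ⟨G, hG, hGd⟩ := hq.exists_finite_wayBelowSet d
    exact ⟨G, hG, d, hd, hGd⟩
  · rintro G ⟨hG, d, hd, hGd⟩ H ⟨hH, e, he, hHe⟩
    obtain ⟨f, hf, hdf, hef⟩ := hdir d hd e he
    obtain ⟨K, hK, hKf, hKG, hKH⟩ :=
      hq.exists_finite_wayBelowSet_subset hG hH (hGd.mono_right hdf) (hHe.mono_right hef)
    exact ⟨K, ⟨hK, f, hf, hKf⟩, hKG, hKH⟩
  · intro E t hE hEdir ht htG
    refine hFs E t hE hEdir ht (mem_upSet_singleton.2 (hs.2 fun d hd => ?_))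
    exact hq.le_of_forall_mem_upSet fun G hG hGd => htG G ⟨hG, d, hd, hGd⟩

/-- An upper set meeting every directed set whose supremum is above `x` contains a finite set
way below `x`. -/
lemma IsQuasicontinuousDomain.exists_finite_subset_wayBelowSet (hdcpo : IsDcpo P)
    (hq : IsQuasicontinuousDomain P) {x : P} {W : Set P} (hW : IsUpperSet W)
    (hmeet : WayBelowSet W {x}) : ∃ F ⊆ W, F.Finite ∧ WayBelowSet F {x} := by
  suffices h : ∃ F ∈ {F : Set P | F.Finite ∧ WayBelowSet F {x}}, F ⊆ W by
    obtain ⟨F, ⟨hF, hFx⟩, hFW⟩ := h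
    exact ⟨F, hFW, hF, hFx⟩
  refine exists_mem_subset_of_forall_directedOn hdcpo (hq.exists_finite_wayBelowSet x)
    (fun F hF => hF.1) (fun F hF G hG => ?_) hW ?_
  · obtain ⟨H, hH, hHx, hHF, hHG⟩ := hq.exists_finite_wayBelowSet_subset hF.1 hG.1 hF.2 hG.2
    exact ⟨H, ⟨hH, hHx⟩, hHF, hHG⟩
  · intro D t hD hdir ht htF
    obtain ⟨d, hdD, w, hw, hwd⟩ := hmeet D t hD hdir ht
      (mem_upSet_singleton.2 (hq.le_of_forall_mem_upSet fun F hF hFx => htF F ⟨hF, hFx⟩))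
    exact ⟨d, hdD, hW hwd hw⟩

lemma MeetContinuous.exists_mem_of_scottOpen (hm : MeetContinuous P) {U D : Set P} {x s : P}
    (hU : ScottOpen U) (hxU : x ∈ U) (hD : D.Nonempty) (hdir : DirectedOn (· ≤ ·) D)
    (hs : IsLUB D s) (hxs : x ≤ s) : ∃ y ∈ U, y ≤ x ∧ y ∈ downSet D := by
  obtain ⟨y, hyU, hyx, hyD⟩ :=
    (@mem_closure_iff P (scottT P) _ _).1 (hm x D s hD hdir hs hxs) U hU hxU
  exact ⟨y, hyU, hyx, hyD⟩

/-- In a meet-continuous dcpo, a point of a Scott open set contained in `↑F`, with `F` finite,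
has an element of `F` way below it. -/
lemma MeetContinuous.exists_wayBelowPt (hm : MeetContinuous P) {U F : Set P} {x : P}
    (hF : F.Finite) (hU : ScottOpen U) (hUF : U ⊆ upSet F) (hxU : x ∈ U) :
    ∃ a ∈ F, WayBelowPt a x := by
  by_contra! hcon
  have hex : ∀ a ∈ F, ∃ D : Set P, ∃ s, D.Nonempty ∧ DirectedOn (· ≤ ·) D ∧ IsLUB D s ∧ x ≤ s ∧
      a ∉ downSet D := fun a ha => by
    have h := hcon a ha
    unfold WayBelowPt at h
    push Not at h
    obtain ⟨D, s, hD, hdir, hs, hxs, hDa⟩ := h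
    exact ⟨D, s, hD, hdir, hs, hxs, fun ⟨d, hd, had⟩ => hDa d hd had⟩
  have step : ∀ G : Set P, G.Finite → G ⊆ F → ∃ y ∈ U, y ≤ x ∧ ∀ a ∈ G, ¬ a ≤ y := by
    intro G hG
    induction G, hG using Set.Finite.induction_on with
    | empty => exact fun _ => ⟨x, hxU, le_rfl, by simp⟩
    | @insert a G _ _ ih =>
      intro hGF
      obtain ⟨y, hyU, hyx, hy⟩ := ih ((subset_insert a G).trans hGF)
      obtain ⟨D, s, hD, hdir, hs, hxs, haD⟩ := hex a (hGF (mem_insert a G))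
      obtain ⟨z, hzU, hzy, d, hd, hzd⟩ :=
        hm.exists_mem_of_scottOpen hU hyU hD hdir hs (hyx.trans hxs)
      refine ⟨z, hzU, hzy.trans hyx, ?_⟩
      rintro b (rfl | hb) hbz
      · exact haD ⟨d, hd, hbz.trans hzd⟩
      · exact hy b hb (hbz.trans hzy)
  obtain ⟨y, hyU, -, hy⟩ := step F hF Subset.rfl
  obtain ⟨a, ha, hay⟩ := hUF hyU
  exact hy a ha hay

/-- In a meet-continuous quasicontinuous domain, an upper set meeting every directed set whose
supremum is above `x` contains a point way below `x`. -/
lemma IsQuasicontinuousDomain.exists_mem_wayBelowPt (hdcpo : IsDcpo P)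
    (hq : IsQuasicontinuousDomain P) (hm : MeetContinuous P) {x : P} {W : Set P}
    (hW : IsUpperSet W) (hmeet : WayBelowSet W {x}) : ∃ u ∈ W, WayBelowPt u x := by
  obtain ⟨F, hFW, hF, hFx⟩ := hq.exists_finite_subset_wayBelowSet hdcpo hW hmeet
  obtain ⟨u, hu, hux⟩ := hm.exists_wayBelowPt hF (hq.scottOpen_setOf_wayBelowSet hdcpo F)
    (fun _ hy => hy.mem_upSet) hFx
  exact ⟨u, hFW hu, hux⟩

lemma IsQuasicontinuousDomain.isContinuousDomain (hdcpo : IsDcpo P)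
    (hq : IsQuasicontinuousDomain P) (hm : MeetContinuous P) : IsContinuousDomain P := by
  intro x
  refine ⟨?_, fun a ha b hb => ?_, fun u hu => hu.le, fun y hy => ?_⟩
  · obtain ⟨u, -, hu⟩ := hq.exists_mem_wayBelowPt hdcpo hm (x := x) isUpperSet_univ
      fun D s hD _ _ _ => hD.imp fun d hd => ⟨hd, subset_upSet _ (mem_univ d)⟩
    exact ⟨u, hu⟩
  · obtain ⟨u, ⟨hau, hbu⟩, hu⟩ := hq.exists_mem_wayBelowPt hdcpo hm (x := x)
      ((isUpperSet_Ici a).inter (isUpperSet_Ici b)) fun D s hD hdir hs hx => by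
        obtain ⟨d, hd, had⟩ := ha D s hD hdir hs (mem_upSet_singleton.1 hx)
        obtain ⟨e, he, hbe⟩ := hb D s hD hdir hs (mem_upSet_singleton.1 hx)
        obtain ⟨f, hf, hdf, hef⟩ := hdir d hd e he
        exact ⟨f, hf, subset_upSet _ ⟨had.trans hdf, hbe.trans hef⟩⟩
    exact ⟨u, hu, hau, hbu⟩
  · by_contra hxy
    obtain ⟨u, huy, hu⟩ := hq.exists_mem_wayBelowPt hdcpo hm (x := x)
      (isLowerSet_Iic y).compl fun D s hD hdir hs hx => by
        by_contra hcon
        refine hxy ((mem_upSet_singleton.1 hx).trans (hs.2 fun d hd => ?_))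
        by_contra hdy
        exact hcon ⟨d, hd, subset_upSet _ hdy⟩
    exact huy (hy hu)

lemma IsContinuousDomain.isQuasicontinuousDomain (hc : IsContinuousDomain P) :
    IsQuasicontinuousDomain P := by
  intro x
  obtain ⟨hne, hdir, hlub⟩ := hc x
  have mem {u : P} (hu : WayBelowPt u x) : upSet {u} ∈ finWayFamily x :=
    ⟨{u}, singleton_nonempty u, finite_singleton u, hu.wayBelowSet, rfl⟩
  refine ⟨⟨?_, ?_⟩, Subset.antisymm ?_ ?_⟩
  · obtain ⟨u, hu⟩ := hne
    exact ⟨_, mem hu⟩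
  · rintro _ ⟨F, -, -, hF, rfl⟩ _ ⟨G, -, -, hG, rfl⟩
    obtain ⟨u, hu, huF⟩ := hF _ x hne hdir hlub (mem_upSet_singleton.2 le_rfl)
    obtain ⟨v, hv, hvG⟩ := hG _ x hne hdir hlub (mem_upSet_singleton.2 le_rfl)
    obtain ⟨w, hw, huw, hvw⟩ := hdir u hu v hv
    exact ⟨_, mem hw,
      fun z hz => isUpperSet_upSet F (huw.trans (mem_upSet_singleton.1 hz)) huF,
      fun z hz => isUpperSet_upSet G (hvw.trans (mem_upSet_singleton.1 hz)) hvG⟩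
  · rintro y hxy _ ⟨F, -, -, hF, rfl⟩
    exact isUpperSet_upSet F hxy hF.mem_upSet
  · exact fun y hy => hlub.2 fun u hu => mem_upSet_singleton.1 (hy _ (mem hu))

lemma IsContinuousDomain.meetContinuous (hc : IsContinuousDomain P) : MeetContinuous P := by
  intro x D s hD hdir hs hxs
  refine (@mem_closure_iff P (scottT P) _ _).2 fun U hU hxU => ?_
  obtain ⟨hne, hdirx, hlub⟩ := hc x
  obtain ⟨u, hu, huU⟩ := hU.2 _ x hne hdirx hlub hxU
  obtain ⟨d, hd, hud⟩ := hu D s hD hdir hs hxs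
  exact ⟨u, huU, hu.le, d, hd, hud⟩

end WayBelow

/-- A dcpo is a continuous domain iff it is a quasicontinuous domain and
meet-continuous. -/
theorem continuous_iff_quasicontinuous_and_meetContinuous
    (P : Type*) [PartialOrder P] (hdcpo : IsDcpo P) :
    IsContinuousDomain P ↔ IsQuasicontinuousDomain P ∧ MeetContinuous P := by
  exact ⟨fun hc => ⟨hc.isQuasicontinuousDomain, hc.meetContinuous⟩,
    fun ⟨hq, hm⟩ => hq.isContinuousDomain hdcpo hm⟩
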